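/- (Step 2 of Lemma 2.2: equality of the left and right ψ-fractional semi-norms on ℝ.) For every v ∈ C_c^∞(ℝ), ∫_ℝ |(_{-∞}D^{δ,ψ}_t v)(t)|² ψ'(t) dt = ∫_ℝ |(_tD^{δ,ψ}_{+∞} v)(t)|² ψ'(t) dt. -/

import Mathlib

open MeasureTheory Real

/-- Left ψ-Riemann–Liouville derivative on the whole line. -/
noncomputable def leftRLDLine (ψ : ℝ → ℝ) (μ : ℝ) (v : ℝ → ℝ) (t : ℝ) : ℝ :=
  (1 / deriv ψ t) *
    deriv (fun τ => (1 / Real.Gamma (1 - μ)) *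
      ∫ z in Set.Iio τ, deriv ψ z * (ψ τ - ψ z) ^ (-μ) * v z) t

/-- Right ψ-Riemann–Liouville derivative on the whole line. -/
noncomputable def rightRLDLine (ψ : ℝ → ℝ) (μ : ℝ) (v : ℝ → ℝ) (t : ℝ) : ℝ :=
  -(1 / deriv ψ t) *
    deriv (fun τ => (1 / Real.Gamma (1 - μ)) *
      ∫ z in Set.Ioi τ, deriv ψ z * (ψ z - ψ τ) ^ (-μ) * v z) t

open Set Filter Topology Convolution

/-- Convolving an integrable kernel with `g` or with its reflection gives the same `L²` norm. -/
theorem integral_sq_convolution_reflect {k g : ℝ → ℝ} (hk : Integrable k) (hg : Continuous g)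
    (hgs : HasCompactSupport g) :
    Integrable (fun s => (∫ u, k u * g (s - u)) ^ 2) ∧
      ∫ s, (∫ u, k u * g (s - u)) ^ 2 = ∫ s, (∫ u, k u * g (u - s)) ^ 2 := by
  obtain ⟨C, hC⟩ := hg.bounded_above_of_compact_support hgs
  have hgi : Integrable g := hg.integrable_of_hasCompactSupport hgs
  have sq_eq (h : ℝ → ℝ) :
      (∫ u, k u * h u) ^ 2 = ∫ p : ℝ × ℝ, k p.1 * h p.1 * (k p.2 * h p.2) := by
    rw [Measure.volume_eq_prod, integral_prod_mul (fun u => k u * h u) (fun u => k u * h u), sq]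
  have hkk : Integrable (fun p : ℝ × ℝ => k p.1 * k p.2) (volume.prod volume) := hk.mul_prod hk
  have key (σ : ℝ → ℝ → ℝ) (hσ : Continuous (Function.uncurry σ))
      (hσi : ∀ a, Integrable (fun s => g (σ s a)))
      (hσn : ∀ a, ∫ s, ‖g (σ s a)‖ = ∫ s, ‖g s‖) :
      Integrable (fun q : ℝ × (ℝ × ℝ) =>
        k q.2.1 * g (σ q.1 q.2.1) * (k q.2.2 * g (σ q.1 q.2.2)))
        (volume.prod (volume.prod volume)) := by
    have m1 : AEStronglyMeasurable (fun q : ℝ × (ℝ × ℝ) => k q.2.1 * k q.2.2)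
        (volume.prod (volume.prod volume)) := hkk.aestronglyMeasurable.comp_snd
    have m2 : Continuous (fun q : ℝ × (ℝ × ℝ) => g (σ q.1 q.2.1) * g (σ q.1 q.2.2)) :=
      (hg.comp (hσ.comp (by fun_prop : Continuous fun q : ℝ × (ℝ × ℝ) => (q.1, q.2.1)))).mul
        (hg.comp (hσ.comp (by fun_prop : Continuous fun q : ℝ × (ℝ × ℝ) => (q.1, q.2.2))))
    have hm : AEStronglyMeasurable (fun q : ℝ × (ℝ × ℝ) =>
        k q.2.1 * g (σ q.1 q.2.1) * (k q.2.2 * g (σ q.1 q.2.2)))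
        (volume.prod (volume.prod volume)) := by
      refine (m1.mul m2.aestronglyMeasurable).congr (Eventually.of_forall fun q => ?_)
      simp only [Pi.mul_apply]
      ring
    have hcs (a : ℝ) : Continuous fun s => g (σ s a) :=
      hg.comp (hσ.comp (by fun_prop : Continuous fun s : ℝ => (s, a)))
    have hi (p : ℝ × ℝ) :
        Integrable (fun s => k p.1 * g (σ s p.1) * (k p.2 * g (σ s p.2))) := by
      have := ((hσi p.1).mul_bdd (hcs p.2).aestronglyMeasurable
        (Eventually.of_forall fun s => hC (σ s p.2))).const_mul (k p.1 * k p.2)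
      refine this.congr (Eventually.of_forall fun s => ?_)
      simp only
      ring
    rw [integrable_prod_iff' hm]
    refine ⟨Eventually.of_forall hi, ?_⟩
    refine (hkk.norm.mul_const (C * ∫ s, ‖g s‖)).mono' hm.norm.prod_swap.integral_prod_right'
      (Eventually.of_forall fun p => ?_)
    rw [norm_of_nonneg (integral_nonneg fun _ => norm_nonneg _), ← hσn p.1, ← integral_const_mul,
      ← integral_const_mul]
    refine integral_mono (hi p).norm (((hσi p.1).norm.const_mul C).const_mul _) fun s => ?_
    simp only [norm_mul]
    have h := mul_le_mul_of_nonneg_left (hC (σ s p.2))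
      (by positivity : 0 ≤ ‖k p.1‖ * ‖k p.2‖ * ‖g (σ s p.1)‖)
    linarith
  have hL := key (fun s a => s - a) (by fun_prop) (fun a => hgi.comp_sub_right a)
    (fun a => integral_sub_right_eq_self (fun s => ‖g s‖) a)
  have hR := key (fun s a => a - s) (by fun_prop) (fun a => hgi.comp_sub_left a)
    (fun a => integral_sub_left_eq_self (fun s => ‖g s‖) volume a)
  refine ⟨?_, ?_⟩
  · simp_rw [sq_eq]
    exact hL.integral_prod_left
  · simp_rw [sq_eq]
    refine (integral_integral_swap (f := fun s (p : ℝ × ℝ) =>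
      k p.1 * g (s - p.1) * (k p.2 * g (s - p.2))) hL).trans (Eq.trans ?_
      (integral_integral_swap (f := fun s (p : ℝ × ℝ) =>
        k p.1 * g (p.1 - s) * (k p.2 * g (p.2 - s))) hR).symm)
    refine integral_congr_ae (Eventually.of_forall fun p => ?_)
    simp only
    rw [← integral_sub_left_eq_self _ volume (p.1 + p.2)]
    refine integral_congr_ae (Eventually.of_forall fun s => ?_)
    simp only
    rw [show p.1 + p.2 - s - p.1 = p.2 - s by ring, show p.1 + p.2 - s - p.2 = p.1 - s by ring]
    ring

/-- The `L²` norm of a convolution with a kernel vanishing at `+∞` is the limit of the norms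
obtained by truncating the kernel. -/
theorem tendsto_lintegral_sq_truncated_convolution {k g : ℝ → ℝ} (hk : LocallyIntegrable k)
    (hk0 : Tendsto k atTop (𝓝 0)) (hg : Continuous g) (hgs : HasCompactSupport g) :
    Tendsto (fun N : ℝ =>
        ∫⁻ s, ENNReal.ofReal ((∫ u, (Iic N).indicator k u * g (s - u)) ^ 2)) atTop
      (𝓝 (∫⁻ s, ENNReal.ofReal ((∫ u, k u * g (s - u)) ^ 2))) := by
  obtain ⟨M, hM, hgM⟩ := hgs.exists_pos_le_norm
  have hgi : Integrable g := hg.integrable_of_hasCompactSupport hgs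
  have hcont : Continuous fun s => ∫ u, k u * g (s - u) :=
    hgs.continuous_convolution_right (ContinuousLinearMap.mul ℝ ℝ) hk hg
  have hmain := (aecover_Iic (μ := (volume : Measure ℝ))
    (tendsto_atTop_add_const_right atTop (-M) tendsto_id)).lintegral_tendsto_of_countably_generated
    (f := fun s => ENNReal.ofReal ((∫ u, k u * g (s - u)) ^ 2)) (hcont.pow 2).measurable.ennreal_ofReal.aemeasurable
  have htail : Tendsto (fun N : ℝ => ∫⁻ s in (Iic (N + -M))ᶜ,
      ENNReal.ofReal ((∫ u, (Iic N).indicator k u * g (s - u)) ^ 2)) atTop (𝓝 0) := by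
    rw [ENNReal.tendsto_nhds_zero]
    intro ε hε
    set G := ∫ s, ‖g s‖
    have hη : Tendsto (fun η : ℝ => ENNReal.ofReal ((η * G) ^ 2) * ENNReal.ofReal (2 * M))
        (𝓝[>] 0) (𝓝 0) := by
      have : Continuous fun η : ℝ => ENNReal.ofReal ((η * G) ^ 2 * (2 * M)) :=
        ENNReal.continuous_ofReal.comp (by fun_prop)
      have h0 := (this.tendsto 0).mono_left (nhdsWithin_le_nhds (s := Ioi 0))
      simp_rw [← ENNReal.ofReal_mul (sq_nonneg _)]
      simpa using h0
    obtain ⟨η, hηε, hηpos⟩ :=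
      ((ENNReal.tendsto_nhds_zero.1 hη ε hε).and self_mem_nhdsWithin).exists
    obtain ⟨B, hB⟩ := eventually_atTop.1 (hk0.norm.eventually_le_const
      (by simpa using hηpos : ‖(0 : ℝ)‖ < η))
    filter_upwards [eventually_ge_atTop (B + 2 * M)] with N hN
    refine le_trans ?_ hηε
    calc ∫⁻ s in (Iic (N + -M))ᶜ,
          ENNReal.ofReal ((∫ u, (Iic N).indicator k u * g (s - u)) ^ 2)
        ≤ ∫⁻ s in (Iic (N + -M))ᶜ,
            (Ioc (N - M) (N + M)).indicator (fun _ => ENNReal.ofReal ((η * G) ^ 2)) s := by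
          refine setLIntegral_mono' measurableSet_Iic.compl fun s hs => ?_
          simp only [mem_compl_iff, mem_Iic, not_le] at hs
          by_cases hsM : s ≤ N + M
          · rw [indicator_of_mem (by constructor <;> linarith)]
            refine ENNReal.ofReal_le_ofReal (sq_le_sq' ?_ ?_) <;>
            [refine (abs_le.1 ?_).1; refine (abs_le.1 ?_).2] <;>
            · rw [← Real.norm_eq_abs,
                show η * G = ∫ u, η * ‖g (s - u)‖ by
                  rw [integral_const_mul, integral_sub_left_eq_self (fun u => ‖g u‖)]]
              refine norm_integral_le_of_norm_le ((hgi.comp_sub_left s).norm.const_mul η)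
                (Eventually.of_forall fun u => ?_)
              rw [norm_mul]
              by_cases hu : g (s - u) = 0
              · simp [hu]
              · have : ‖s - u‖ < M := by
                  by_contra! h
                  exact hu (hgM _ h)
                have := (abs_lt.1 this).2
                gcongr
                exact (norm_indicator_le_norm_self _ _).trans (hB u (by linarith))
          · rw [integral_eq_zero_of_ae]
            · simp
            refine Eventually.of_forall fun u => ?_
            by_cases hu : u ≤ N
            · simp [hgM (s - u) (le_trans (by linarith) (le_abs_self _))]
            · simp [hu]
      _ ≤ ∫⁻ s, (Ioc (N - M) (N + M)).indicator (fun _ => ENNReal.ofReal ((η * G) ^ 2)) s :=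
          setLIntegral_le_lintegral _ _
      _ = ENNReal.ofReal ((η * G) ^ 2) * ENNReal.ofReal (2 * M) := by
          rw [lintegral_indicator measurableSet_Ioc, setLIntegral_const, Real.volume_Ioc]
          congr 2
          ring
  have hsum := hmain.add htail
  rw [add_zero] at hsum
  refine hsum.congr fun N => ?_
  refine Eq.trans ?_ (lintegral_add_compl _ (measurableSet_Iic (a := N + -M)))
  congr 1
  refine setLIntegral_congr_fun (measurableSet_Iic (a := N + -M)) fun s hs => ?_
  simp only [id, mem_Iic] at hs
  congr 3
  ext u
  by_cases hu : u ≤ N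
  · simp [hu]
  · rw [hgM (s - u) (le_trans (by linarith) (neg_le_abs _)), mul_zero, mul_zero]

/-- Convolving a causal, locally integrable kernel vanishing at `+∞` with `g` or with its
reflection gives the same `L²` norm, which may be infinite. -/
theorem integral_sq_convolution_reflect_of_tendsto_zero {k g : ℝ → ℝ} (hk : LocallyIntegrable k)
    (hkneg : ∀ u ≤ 0, k u = 0) (hk0 : Tendsto k atTop (𝓝 0)) (hg : Continuous g)
    (hgs : HasCompactSupport g) :
    ∫ s, (∫ u, k u * g (s - u)) ^ 2 = ∫ s, (∫ u, k u * g (-(s - u))) ^ 2 := by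
  have hg' : Continuous fun x => g (-x) := by fun_prop
  have hgs' : HasCompactSupport fun x => g (-x) := hgs.comp_homeomorph (Homeomorph.neg ℝ)
  have hc {h : ℝ → ℝ} (hh : Continuous h) (hhs : HasCompactSupport h) :
      Continuous fun s => ∫ u, k u * h (s - u) :=
    hhs.continuous_convolution_right (ContinuousLinearMap.mul ℝ ℝ) hk hh
  rw [integral_eq_lintegral_of_nonneg_ae (Eventually.of_forall fun s => sq_nonneg _)
      ((hc hg hgs).pow 2).aestronglyMeasurable,
    integral_eq_lintegral_of_nonneg_ae (Eventually.of_forall fun s => sq_nonneg _)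
      ((hc hg' hgs').pow 2).aestronglyMeasurable]
  congr 1
  refine tendsto_nhds_unique (tendsto_lintegral_sq_truncated_convolution hk hk0 hg hgs)
    ((tendsto_lintegral_sq_truncated_convolution hk hk0 hg' hgs').congr fun N => ?_)
  have hkN : Integrable ((Iic N).indicator k) := by
    have h : (Iic N).indicator k = (Icc 0 N).indicator k := by
      ext u
      rcases le_or_gt u 0 with hu | hu
      · simp [indicator_apply, hkneg u hu]
      · simp [indicator_apply, hu.le]
    rw [h, integrable_indicator_iff measurableSet_Icc]
    exact hk.integrableOn_isCompact isCompact_Icc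
  have h1 := integral_sq_convolution_reflect hkN hg hgs
  have h2 := integral_sq_convolution_reflect hkN hg' hgs'
  rw [← ofReal_integral_eq_lintegral_ofReal h1.1 (Eventually.of_forall fun s => sq_nonneg _),
    ← ofReal_integral_eq_lintegral_ofReal h2.1 (Eventually.of_forall fun s => sq_nonneg _), h1.2]
  simp only [neg_sub]

/-- The kernel of the left Riemann–Liouville integral of order `1 - μ`, without the Gamma
factor. -/
noncomputable def rlKernel (μ : ℝ) : ℝ → ℝ := (Ioi 0).indicator fun u => u ^ (-μ)

theorem locallyIntegrable_rlKernel {μ : ℝ} (hμ : μ < 1) : LocallyIntegrable (rlKernel μ) := by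
  refine LocallyIntegrable.indicator (fun x => ?_) measurableSet_Ioi
  refine ⟨Ioc (x - 1) (x + 1), Ioc_mem_nhds (by linarith) (by linarith), ?_⟩
  exact (intervalIntegrable_iff_integrableOn_Ioc_of_le (by linarith)).1
    (intervalIntegral.intervalIntegrable_rpow' (by linarith))

theorem rlKernel_of_nonpos {μ u : ℝ} (hu : u ≤ 0) : rlKernel μ u = 0 := by
  simp [rlKernel, hu]

theorem tendsto_rlKernel_atTop {μ : ℝ} (hμ : 0 < μ) : Tendsto (rlKernel μ) atTop (𝓝 0) := by
  refine (tendsto_rpow_neg_atTop hμ).congr' ?_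
  filter_upwards [eventually_gt_atTop 0] with u hu
  simp [rlKernel, hu]

/-- Change of variables along an increasing `C¹` bijection of the line. -/
theorem integral_comp_mul_deriv_of_bijective {ψ : ℝ → ℝ} (hψ : Differentiable ℝ ψ)
    (hbij : Function.Bijective ψ) (hψ' : ∀ t, 0 < deriv ψ t) (f : ℝ → ℝ) :
    ∫ t, deriv ψ t * f (ψ t) = ∫ s, f s := by
  have h := integral_image_eq_integral_abs_deriv_smul MeasurableSet.univ
    (fun x _ => (hψ x).hasDerivAt.hasDerivWithinAt) hbij.1.injOn f
  rw [image_univ, hbij.2.range_eq, Measure.restrict_univ] at h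
  rw [h]
  simp only [abs_of_pos (hψ' _), smul_eq_mul]

section Transfer

variable {δ : ℝ} {ψ w : ℝ → ℝ}

theorem leftRLDLine_comp (hδ1 : δ < 1) (hψ : Differentiable ℝ ψ) (hmono : StrictMono ψ)
    (hbij : Function.Bijective ψ) (hψ' : ∀ t, 0 < deriv ψ t)
    (hw : ContDiff ℝ 1 w) (hws : HasCompactSupport w) (t : ℝ) :
    leftRLDLine ψ δ (fun z => w (ψ z)) t =
      1 / Real.Gamma (1 - δ) * ∫ u, rlKernel δ u * deriv w (ψ t - u) := by
  have hF : (fun τ => ∫ z in Iio τ, deriv ψ z * (ψ τ - ψ z) ^ (-δ) * w (ψ z)) =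
      fun τ => (rlKernel δ ⋆[ContinuousLinearMap.mul ℝ ℝ] w) (ψ τ) := by
    ext τ
    rw [convolution_eq_swap, ← integral_comp_mul_deriv_of_bijective hψ hbij hψ',
      ← integral_indicator measurableSet_Iio]
    congr 1 with z
    by_cases hz : z < τ
    · simp [rlKernel, hz, hmono hz, mul_assoc]
    · simp [rlKernel, hz, hmono.lt_iff_lt]
  have hd := (hws.hasDerivAt_convolution_right (ContinuousLinearMap.mul ℝ ℝ)
    (locallyIntegrable_rlKernel hδ1) hw (ψ t)).comp t (hψ t).hasDerivAt
  unfold leftRLDLine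
  rw [deriv_const_mul_field, hF]
  erw [hd.deriv]
  rw [convolution_def]
  have := (hψ' t).ne'
  simp only [ContinuousLinearMap.mul_apply']
  field_simp

theorem rightRLDLine_comp (hδ1 : δ < 1) (hψ : Differentiable ℝ ψ) (hmono : StrictMono ψ)
    (hbij : Function.Bijective ψ) (hψ' : ∀ t, 0 < deriv ψ t)
    (hw : ContDiff ℝ 1 w) (hws : HasCompactSupport w) (t : ℝ) :
    rightRLDLine ψ δ (fun z => w (ψ z)) t =
      -(1 / Real.Gamma (1 - δ) * ∫ u, rlKernel δ u * deriv w (-(-ψ t - u))) := by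
  have hF : (fun τ => ∫ z in Ioi τ, deriv ψ z * (ψ z - ψ τ) ^ (-δ) * w (ψ z)) =
      fun τ => (rlKernel δ ⋆[ContinuousLinearMap.mul ℝ ℝ] fun x => w (-x)) (-ψ τ) := by
    ext τ
    rw [convolution_eq_swap, ← integral_neg_eq_self _ volume,
      ← integral_comp_mul_deriv_of_bijective hψ hbij hψ', ← integral_indicator measurableSet_Ioi]
    congr 1 with z
    by_cases hz : τ < z
    · simp [rlKernel, hz, hmono hz, mul_assoc, neg_add_eq_sub]
    · simp [rlKernel, hz, hmono.lt_iff_lt]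
  have hd := (HasCompactSupport.hasDerivAt_convolution_right (ContinuousLinearMap.mul ℝ ℝ)
    (locallyIntegrable_rlKernel hδ1) (hws.comp_homeomorph (Homeomorph.neg ℝ))
    (hw.comp contDiff_neg) (-ψ t)).comp t (hψ t).hasDerivAt.neg
  have hd' : deriv (w ∘ Neg.neg) = fun x => -deriv w (-x) := by
    ext x
    exact deriv_comp_neg w x
  unfold rightRLDLine
  rw [deriv_const_mul_field, hF]
  erw [hd.deriv]
  have := (hψ' t).ne'
  simp only [convolution_def, ContinuousLinearMap.mul_apply']
  erw [hd']
  simp only [mul_neg, integral_neg]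
  field_simp

end Transfer

/-- Equality of the left and right ψ-fractional semi-norms on ℝ. -/
theorem left_right_psi_seminorm_eq
    (δ : ℝ) (hδ0 : 0 < δ) (hδ1 : δ < 1)
    (ψ : ℝ → ℝ) (hψ : ContDiff ℝ 1 ψ) (hmono : StrictMono ψ)
    (hbij : Function.Bijective ψ) (hψ' : ∀ t, 0 < deriv ψ t)
    (v : ℝ → ℝ) (hv : ContDiff ℝ (⊤ : ℕ∞) v) (hsupp : HasCompactSupport v) :
    ∫ t : ℝ, (leftRLDLine ψ δ v t) ^ 2 * deriv ψ t
      = ∫ t : ℝ, (rightRLDLine ψ δ v t) ^ 2 * deriv ψ t := by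
  have hψd : Differentiable ℝ ψ := hψ.differentiable one_ne_zero
  let e : ℝ ≃ₜ ℝ := (hmono.orderIsoOfSurjective ψ hbij.2).toHomeomorph
  have he (x : ℝ) : e.symm (ψ x) = x := e.symm_apply_apply x
  have hes : ContDiff ℝ 1 e.symm :=
    e.contDiff_symm_deriv (fun x => (hψ' x).ne') (fun x => (hψd x).hasDerivAt) hψ
  obtain ⟨w, hw, hws, rfl⟩ :
      ∃ w : ℝ → ℝ, ContDiff ℝ 1 w ∧ HasCompactSupport w ∧ v = fun z => w (ψ z) :=
    ⟨v ∘ e.symm, (hv.of_le (by exact_mod_cast le_top)).comp hes, hsupp.comp_homeomorph e.symm,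
      by ext z; simp [he]⟩
  simp only [leftRLDLine_comp hδ1 hψd hmono hbij hψ' hw hws,
    rightRLDLine_comp hδ1 hψd hmono hbij hψ' hw hws, neg_sq, mul_pow, mul_comm _ (deriv ψ _)]
  rw [integral_comp_mul_deriv_of_bijective hψd hbij hψ' (fun s => (1 / Real.Gamma (1 - δ)) ^ 2 *
      (∫ u, rlKernel δ u * deriv w (s - u)) ^ 2),
    integral_comp_mul_deriv_of_bijective hψd hbij hψ' (fun s => (1 / Real.Gamma (1 - δ)) ^ 2 *
      (∫ u, rlKernel δ u * deriv w (-(-s - u))) ^ 2),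
    integral_neg_eq_self (fun s => (1 / Real.Gamma (1 - δ)) ^ 2 *
      (∫ u, rlKernel δ u * deriv w (-(s - u))) ^ 2),
    integral_const_mul, integral_const_mul,
    integral_sq_convolution_reflect_of_tendsto_zero (locallyIntegrable_rlKernel hδ1)
      (fun u hu => rlKernel_of_nonpos hu) (tendsto_rlKernel_atTop hδ0)
      (hw.continuous_deriv le_rfl) hws.deriv]
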